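/- In F_q(t), with α̃ = t - 1 and lifting through the divisor E = (N-2)[1] for N > 0, one has ∏_{e ∈ H^0(O_{P^1}((N-2)[1]))} (t - 1 + e) / ((t-1)/t + e) = t^{(q^N - 1)/(q-1)}, where H^0(O_{P^1}((N-2)[1])) = { f ∈ F_q(t) : f regular away from 1, with pole order ≤ N-2 at t = 1 }. -/

import Mathlib

open Polynomial in
/-- The Moore-type matrix with first column `x^(q^j)` and remaining columns `(s^i)^(q^j)`. -/
noncomputable def mooreMat {K : Type*} [Field K] (q n : ℕ) (s x : K) :
    Matrix (Fin (n + 1)) (Fin (n + 1)) K :=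
  Matrix.of fun j k => Fin.cons (α := fun _ => K) (x ^ q ^ (j : ℕ))
    (fun i : Fin n => (s ^ q ^ (j : ℕ)) ^ (i : ℕ)) k

theorem exists_frob (F K : Type*) [Field F] [Fintype F] [Field K] [Algebra F K] (j : ℕ) :
    ∃ φ : K →+* K, (∀ x, φ x = x ^ Fintype.card F ^ j) ∧
      ∀ c : F, φ (algebraMap F K c) = algebraMap F K c := by
  obtain ⟨p, hp⟩ := CharP.exists F
  obtain ⟨m, hprime, hm⟩ := FiniteField.card F p
  have : Fact p.Prime := ⟨hprime⟩
  have : CharP K p := charP_of_injective_algebraMap (algebraMap F K).injective p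
  have h : ∀ x : K, iterateFrobenius K p (m * j) x = x ^ Fintype.card F ^ j := by
    intro x
    rw [iterateFrobenius_def, hm, pow_mul]
  refine ⟨iterateFrobenius K p (m * j), h, fun c => ?_⟩
  rw [h, ← map_pow, FiniteField.pow_card_pow]

section
variable {F K : Type*} [Field F] [Fintype F] [Field K] [Algebra F K]

theorem frob_comb (n j : ℕ) (s : K) (c : Fin n → F) :
    (∑ i, c i • s ^ (i : ℕ)) ^ Fintype.card F ^ j =
      ∑ i, c i • (s ^ Fintype.card F ^ j) ^ (i : ℕ) := by
  obtain ⟨φ, h1, h2⟩ := exists_frob F K j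
  rw [← h1, map_sum]
  refine Finset.sum_congr rfl fun i _ => ?_
  rw [Algebra.smul_def, Algebra.smul_def, map_mul, h2, map_pow, h1]

theorem vander_ne (n : ℕ) (s : K) (hs : Function.Injective fun m : ℕ => s ^ m) :
    (Matrix.vandermonde fun j : Fin n => s ^ Fintype.card F ^ (j : ℕ)).det ≠ 0 := by
  rw [Matrix.det_vandermonde_ne_zero_iff]
  intro a b hab
  have := hs hab
  exact Fin.ext (Nat.pow_right_injective (Fintype.one_lt_card (α := F)) this)

theorem comb_inj (n : ℕ) (s : K) (hs : Function.Injective fun m : ℕ => s ^ m) :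
    Function.Injective fun c : Fin n → F => ∑ i, c i • s ^ (i : ℕ) := by
  have key : ∀ c : Fin n → F, ∑ i, c i • s ^ (i : ℕ) = 0 → c = 0 := by
    intro c hc
    have := Matrix.eq_zero_of_mulVec_eq_zero (vander_ne (F := F) n s hs)
      (v := fun i => algebraMap F K (c i)) (by
        ext j
        have h := frob_comb n (j : ℕ) s c
        rw [hc, zero_pow (pow_pos Fintype.card_pos _).ne'] at h
        simp only [Matrix.mulVec, dotProduct, Matrix.vandermonde_apply, Pi.zero_apply]
        rw [h]
        refine Finset.sum_congr rfl fun i _ => ?_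
        rw [Algebra.smul_def, mul_comm])
    ext i
    have h2 := congrFun this i
    simpa using h2
  intro c d h
  have := key (c - d) (by
    simp only [Pi.sub_apply, sub_smul, Finset.sum_sub_distrib]
    exact sub_eq_zero.2 h)
  exact sub_eq_zero.1 this

open Polynomial in
theorem moore_prod (n : ℕ) (s : K) (hs : Function.Injective fun m : ℕ => s ^ m) :
    ∃ a : K, a ≠ 0 ∧ ∀ x : K, (mooreMat (Fintype.card F) n s x).det =
      a * ∏ c : Fin n → F, (x + ∑ i, c i • s ^ (i : ℕ)) := by
  set q := Fintype.card F with hq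
  have hq1 : 1 < q := Fintype.one_lt_card
  let b : Fin (n + 1) → K := fun j => (-1) ^ (j : ℕ) *
    ((mooreMat q n s 0).submatrix j.succAbove Fin.succ).det
  have hexp : ∀ x, (mooreMat q n s x).det = ∑ j, b j * x ^ q ^ (j : ℕ) := by
    intro x
    rw [Matrix.det_succ_column_zero]
    refine Finset.sum_congr rfl fun j _ => ?_
    have : (mooreMat q n s x).submatrix j.succAbove Fin.succ =
      (mooreMat q n s 0).submatrix j.succAbove Fin.succ := by
      ext i k; simp [mooreMat]
    rw [this]
    simp only [b, mooreMat, Matrix.of_apply, Fin.cons_zero]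
    ring
  have hb : b (Fin.last n) ≠ 0 := by
    refine mul_ne_zero (pow_ne_zero _ (by simp)) ?_
    convert vander_ne (F := F) n s hs using 2
    ext i k
    simp [mooreMat, Matrix.vandermonde_apply, hq]
  let D : K[X] := ∑ j : Fin (n + 1), C (b j) * X ^ q ^ (j : ℕ)
  have hDe : ∀ x, D.eval x = (mooreMat q n s x).det := by
    intro x
    rw [hexp]
    simp [D, eval_finsetSum]
  have hDdeg : D.natDegree ≤ q ^ n := by
    refine natDegree_sum_le_of_forall_le _ _ fun j _ => ?_
    exact (natDegree_C_mul_X_pow_le _ _).trans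
      (Nat.pow_le_pow_right hq1.le (Nat.lt_succ_iff.1 j.2))
  have hDc : D.coeff (q ^ n) = b (Fin.last n) := by
    simp only [D, finsetSum_coeff, coeff_C_mul_X_pow]
    rw [Finset.sum_eq_single (Fin.last n)]
    · simp
    · intro j _ hj
      rw [if_neg]
      intro h
      exact hj (Fin.ext (by simpa using (Nat.pow_right_injective hq1 h).symm))
    · simp
  let Q : K[X] := ∏ c : Fin n → F, (X - C (∑ i, c i • s ^ (i : ℕ)))
  have hQm : Q.Monic := monic_prod_of_monic _ _ fun c _ => monic_X_sub_C _
  have hQd : Q.natDegree = q ^ n := by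
    simp only [Q]
    rw [natDegree_prod_of_monic _ _ fun c _ => monic_X_sub_C _]
    simp only [natDegree_X_sub_C]
    simp [hq]
  have hdvd : Q ∣ D := by
    refine Finset.prod_dvd_of_coprime
      ((pairwise_coprime_X_sub_C (comb_inj (F := F) n s hs)).set_pairwise _) fun c _ => ?_
    rw [dvd_iff_isRoot, IsRoot.def, hDe, ← Matrix.exists_mulVec_eq_zero_iff]
    refine ⟨Fin.cons (α := fun _ => K) (-1) (fun i => algebraMap F K (c i)), ?_, ?_⟩
    · intro h
      have := congrFun h 0
      simp at this
    · ext j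
      simp only [Matrix.mulVec, dotProduct, Fin.sum_univ_succ, mooreMat, Matrix.of_apply,
        Fin.cons_zero, Fin.cons_succ, Pi.zero_apply]
      rw [hq, frob_comb]
      simp only [Algebra.smul_def]
      rw [mul_neg_one, neg_add_eq_zero]
      exact Finset.sum_congr rfl fun i _ => mul_comm _ _
  have hD : D = C D.leadingCoeff * Q :=
    eq_leadingCoeff_mul_of_monic_of_dvd_of_natDegree_le hQm hdvd (by rw [hQd]; exact hDdeg)
  have hl : D.leadingCoeff ≠ 0 := by
    intro h
    rw [leadingCoeff_eq_zero] at h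
    rw [h] at hDc
    exact hb (by simpa using hDc.symm)
  refine ⟨D.leadingCoeff, hl, fun x => ?_⟩
  rw [← hDe]
  conv_lhs => rw [hD]
  rw [eval_mul, eval_C, eval_prod]
  congr 1
  rw [← Equiv.prod_comp (Equiv.neg (Fin n → F))]
  refine Finset.prod_congr rfl fun c _ => ?_
  rw [eval_sub, eval_X, eval_C]
  simp

theorem det_moore_inv (n : ℕ) (s : K) (h0 : s ≠ 0) (q : ℕ) :
    (mooreMat q n s s⁻¹).det = (s⁻¹) ^ (∑ j ∈ Finset.range (n + 1), q ^ j) *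
      (Matrix.vandermonde fun j : Fin (n + 1) => s ^ q ^ (j : ℕ)).det := by
  have h := Matrix.det_mul_column (fun j : Fin (n + 1) => s⁻¹ ^ q ^ (j : ℕ))
    (Matrix.vandermonde fun j : Fin (n + 1) => s ^ q ^ (j : ℕ))
  rw [Finset.prod_pow_eq_pow_sum, Fin.sum_univ_eq_sum_range (fun j => q ^ j)] at h
  rw [← h]
  congr 1
  ext j k
  refine Fin.cases ?_ (fun i => ?_) k
  · simp [mooreMat, Matrix.vandermonde_apply]
  · have : s ^ q ^ (j : ℕ) ≠ 0 := pow_ne_zero _ h0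
    simp only [mooreMat, Matrix.of_apply, Matrix.vandermonde_apply, Fin.cons_succ, Fin.val_succ,
      inv_pow]
    rw [pow_succ', inv_mul_cancel_left₀ this]

open Polynomial in
theorem det_moore_inv' (n : ℕ) (s : K) (h0 : s + 1 ≠ 0) :
    (mooreMat (Fintype.card F) n s (s + 1)⁻¹).det =
      ((s + 1)⁻¹) ^ (∑ j ∈ Finset.range (n + 1), Fintype.card F ^ j) *
      (Matrix.vandermonde fun j : Fin (n + 1) => s ^ Fintype.card F ^ (j : ℕ)).det := by
  set q := Fintype.card F with hq
  let p : Fin (n + 1) → K[X] := Fin.cons (α := fun _ => K[X]) 1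
    (fun i : Fin n => (X + C 1) * X ^ (i : ℕ))
  have hp2 : ∀ i, (p i).Monic := by
    intro i
    refine Fin.cases ?_ (fun i => ?_) i
    · simp [p]
    · simp only [p, Fin.cons_succ]
      exact (monic_X_add_C 1).mul (monic_X_pow _)
  have hp1 : ∀ i, (p i).natDegree = i := by
    intro i
    refine Fin.cases ?_ (fun i => ?_) i
    · simp [p]
    · simp only [p, Fin.cons_succ]
      rw [(monic_X_add_C 1).natDegree_mul (monic_X_pow _), natDegree_X_add_C, natDegree_X_pow,
        Fin.val_succ, add_comm]
  rw [Matrix.det_eval_matrixOfPolynomials_eq_det_vandermonde _ p hp1 hp2]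
  have h := Matrix.det_mul_column (fun j : Fin (n + 1) => (s + 1)⁻¹ ^ q ^ (j : ℕ))
    (Matrix.of fun i j => (p j).eval (s ^ q ^ (i : ℕ)))
  rw [Finset.prod_pow_eq_pow_sum, Fin.sum_univ_eq_sum_range (fun j => q ^ j)] at h
  rw [← h]
  congr 1
  ext j k
  refine Fin.cases ?_ (fun i => ?_) k
  · simp [mooreMat, p]
  · have h1 : (s + 1) ^ q ^ (j : ℕ) = s ^ q ^ (j : ℕ) + 1 := by
      obtain ⟨φ, h1, h2⟩ := exists_frob F K j
      rw [hq, ← h1, map_add, h1, map_one]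
    have h2 : s ^ q ^ (j : ℕ) + 1 ≠ 0 := h1 ▸ pow_ne_zero _ h0
    simp only [mooreMat, Matrix.of_apply, Fin.cons_succ, inv_pow, p, h1, eval_mul, eval_add,
      eval_X, eval_C, eval_pow]
    field_simp

theorem main_aux (n : ℕ) (s : K) (hs : Function.Injective fun m : ℕ => s ^ m)
    (h0 : s ≠ 0) (h1 : s + 1 ≠ 0) :
    ∏ c : Fin n → F, ((s⁻¹ + ∑ i, c i • s ^ (i : ℕ)) / ((s + 1)⁻¹ + ∑ i, c i • s ^ (i : ℕ))) =
      ((s + 1) / s) ^ (∑ j ∈ Finset.range (n + 1), Fintype.card F ^ j) := by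
  obtain ⟨a, ha, hx⟩ := moore_prod (F := F) n s hs
  have hA := hx s⁻¹
  have hB := hx (s + 1)⁻¹
  rw [det_moore_inv n s h0] at hA
  rw [det_moore_inv' n s h1] at hB
  have hV := vander_ne (F := F) (n + 1) s hs
  rw [Finset.prod_div_distrib, ← mul_div_mul_left _ _ ha, ← hA, ← hB, mul_div_mul_right _ _ hV,
    ← div_pow]
  congr 1
  field_simp

end

theorem pow_inj_aux (F : Type*) [Field F] :
    Function.Injective fun m : ℕ => ((RatFunc.X : RatFunc F) - 1)⁻¹ ^ m := by
  intro a b h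
  simp only [inv_pow, inv_inj] at h
  have e : (RatFunc.X : RatFunc F) - 1 =
      algebraMap (Polynomial F) (RatFunc F) (Polynomial.X - Polynomial.C 1) := by
    simp
  rw [e, ← map_pow, ← map_pow] at h
  have := congrArg Polynomial.natDegree (RatFunc.algebraMap_injective F h)
  simpa only [Polynomial.natDegree_pow, Polynomial.natDegree_X_sub_C, mul_one] using this


/-- In `F_q(t)`, with lifting `α̃ = t - 1` (resp. `(t-1)/t`) and `E = (N-2)[1]` for
`N > 0`, one has
`∏_{e ∈ H^0(O_{P¹}((N-2)[1]))} (t - 1 + e) / ((t-1)/t + e) = t^{(q^N - 1)/(q-1)}`,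
where `H^0(O_{P¹}((N-2)[1]))` — the space of rational functions regular away from
`t = 1` with pole order `≤ N - 2` there — is the `F_q`-span of
`1, 1/(t-1), ..., 1/(t-1)^{N-2}`, an `F_q`-vector space with `q^{N-1}` elements. -/
theorem hyp_product_formula_P1 (F : Type*) [Field F] [Fintype F]
    (q : ℕ) (hq : Fintype.card F = q) (N : ℕ) (hN : 0 < N) :
    (∏ᶠ e ∈ (Submodule.span F
        (Set.range fun i : Fin (N - 1) => ((RatFunc.X : RatFunc F) - 1)⁻¹ ^ (i : ℕ)) :
        Set (RatFunc F)),
      ((RatFunc.X - 1 + e) / (((RatFunc.X : RatFunc F) - 1) / RatFunc.X + e))) =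
      (RatFunc.X : RatFunc F) ^ ((q ^ N - 1) / (q - 1)) := by
  subst hq
  obtain ⟨n, rfl⟩ : ∃ n, N = n + 1 := ⟨N - 1, by omega⟩
  rw [← Nat.geomSum_eq Fintype.one_lt_card]
  have hs := pow_inj_aux F
  have hne : (RatFunc.X : RatFunc F) - 1 ≠ 0 := by
    intro h
    have h2 := @hs 1 2 (by simp [h])
    omega
  have hX : (RatFunc.X : RatFunc F) ≠ 0 := RatFunc.X_ne_zero
  have e1 : ((RatFunc.X : RatFunc F) - 1)⁻¹ + 1 = RatFunc.X / (RatFunc.X - 1) := by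
    field_simp
    ring
  have hm := main_aux (F := F) n ((RatFunc.X : RatFunc F) - 1)⁻¹ hs (inv_ne_zero hne)
    (by rw [e1]; exact div_ne_zero hX hne)
  have e2 : (RatFunc.X : RatFunc F) / (RatFunc.X - 1) / (RatFunc.X - 1)⁻¹ = RatFunc.X := by
    field_simp
  rw [e1, e2, inv_div, inv_inv] at hm
  rw [← hm, ← Fintype.range_linearCombination, LinearMap.coe_range, finprod_mem_range,
    finprod_eq_prod_of_fintype]
  · rfl
  · exact comb_inj (F := F) n _ hs
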